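/- For all positive integers a and b, the order of rowmotion Row on J(𝐚×𝐛×𝟐), the set of order ideals of the product of chains Fin a × Fin b × Fin 2, is exactly a + b + 1; that is, the least m > 0 with Row^m equal to the identity on J(𝐚×𝐛×𝟐) is a + b + 1. -/

import Mathlib

/-- Rowmotion on order ideals (lower sets) of a poset `P`: `I` is sent to the
order ideal generated by the minimal elements of the complement of `I`. -/
def rowmo {P : Type*} [PartialOrder P] (I : Set P) : Set P :=
  {x | ∃ m, Minimal (fun y => y ∉ I) m ∧ x ≤ m}


/-- minimum of `H` over `u, …, u+n` -/
def rmin (H : ℕ → ℤ) (u : ℕ) : ℕ → ℤ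
  | 0 => H u
  | n + 1 => min (rmin H u n) (H (u + n + 1))

theorem rmin_left (H : ℕ → ℤ) (u n : ℕ) :
    rmin H u (n + 1) = min (H u) (rmin H (u + 1) n) := by
  induction n with
  | zero => simp [rmin]
  | succ n ih =>
    rw [rmin, ih, rmin, min_assoc]
    congr 4
    ring

theorem rmin_le_left (H : ℕ → ℤ) (u n : ℕ) : rmin H u n ≤ H u := by
  induction n with
  | zero => simp [rmin]
  | succ n ih => rw [rmin]; exact (min_le_left _ _).trans ih

theorem rmin_le_right (H : ℕ → ℤ) (u n : ℕ) : rmin H u n ≤ H (u + n) := by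
  cases n with
  | zero => simp [rmin]
  | succ n => rw [rmin]; exact min_le_right _ _

theorem rmin_nonneg (H : ℕ → ℤ) (N : ℕ) (h0 : ∀ i ≤ N, 0 ≤ H i) (u n : ℕ) (hn : u + n ≤ N) :
    0 ≤ rmin H u n := by
  induction n with
  | zero => exact h0 _ hn
  | succ n ih =>
    rw [rmin]
    exact le_min (ih (by omega)) (h0 _ (by omega))

/-- the tree distance of the contour function `H` -/
def tdist (H : ℕ → ℤ) (u v : ℕ) : ℤ := H u + H v - 2 * rmin H u (v - u)

theorem tdist_self (H : ℕ → ℤ) (u : ℕ) : tdist H u u = 0 := by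
  simp [tdist, rmin]; ring

theorem ptolemy (H : ℕ → ℤ) (N : ℕ)
    (hs : ∀ i < N, H (i + 1) = H i + 1 ∨ H (i + 1) = H i - 1)
    (u v : ℕ) (huv : u + 1 ≤ v) (hv : v < N) :
    tdist H u v + tdist H (u + 1) (v + 1) = max (tdist H u (v + 1) + tdist H (u + 1) v) 2 := by
  obtain ⟨n, rfl⟩ := Nat.exists_eq_add_of_le huv
  unfold tdist
  rw [show u + 1 + n - u = n + 1 by omega, show u + 1 + n + 1 - (u + 1) = n + 1 by omega,
    show u + 1 + n + 1 - u = (n + 1) + 1 by omega, show u + 1 + n - (u + 1) = n by omega]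
  rw [rmin_left H u (n + 1), rmin_left H u n, rmin]
  have h1 := rmin_le_left H (u + 1) n
  have h2 := rmin_le_right H (u + 1) n
  have h3 := hs u (by omega)
  have h4 := hs (u + 1 + n) (by omega)
  generalize rmin H (u + 1) n = μ at *
  generalize H (u + 1 + n + 1) = r at *
  generalize H (u + 1 + n) = s at *
  generalize H (u + 1) = t at *
  generalize H u = p at *
  omega

/-- the rotated contour functions -/
def rot (H : ℕ → ℤ) (N K j : ℕ) : ℤ :=
  if K + j ≤ N then tdist H K (K + j) else tdist H (K + j - N) K

theorem tdist_zero (H : ℕ → ℤ) (N : ℕ) (h0 : ∀ i ≤ N, 0 ≤ H i) (hz : H 0 = 0) (j : ℕ)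
    (hj : j ≤ N) : tdist H 0 j = H j := by
  have h1 := rmin_le_left H 0 (j - 0)
  have h2 := rmin_nonneg H N h0 0 (j - 0) (by omega)
  unfold tdist
  omega

theorem tdist_N (H : ℕ → ℤ) (N : ℕ) (h0 : ∀ i ≤ N, 0 ≤ H i) (hz : H N = 0) (j : ℕ)
    (hj : j ≤ N) : tdist H j N = H j := by
  have h1 := rmin_le_right H j (N - j)
  have h2 := rmin_nonneg H N h0 j (N - j) (by omega)
  rw [show j + (N - j) = N by omega] at h1
  unfold tdist
  omega

theorem rot_alt (H : ℕ → ℤ) (N : ℕ) (h0 : ∀ i ≤ N, 0 ≤ H i) (hz : H 0 = 0) (hN : H N = 0)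
    (K j : ℕ) (hK : K ≤ N) (hj : N ≤ K + j) : rot H N K j = tdist H (K + j - N) K := by
  unfold rot
  split_ifs with h
  · have : K + j = N := by omega
    rw [this, tdist_N H N h0 hN K hK, Nat.sub_self, tdist_zero H N h0 hz K hK]
  · rfl

theorem rot_rule (H : ℕ → ℤ) (N : ℕ) (h0 : ∀ i ≤ N, 0 ≤ H i) (hz : H 0 = 0) (hN : H N = 0)
    (hs : ∀ i < N, H (i + 1) = H i + 1 ∨ H (i + 1) = H i - 1)
    (K j : ℕ) (hK : K + 1 ≤ N) (hj : 1 ≤ j) (hj' : j < N) :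
    rot H N (K + 1) j + rot H N K j
      = max (rot H N (K + 1) (j - 1) + rot H N K (j + 1)) 2 := by
  by_cases h : K + 1 + j ≤ N
  · have e := ptolemy H N hs K (K + j) (by omega) (by omega)
    unfold rot
    rw [if_pos h, if_pos (by omega), if_pos (by omega), if_pos (by omega),
      show K + 1 + j = K + j + 1 by omega, show K + 1 + (j - 1) = K + j by omega,
      show K + (j + 1) = K + j + 1 by omega]
    omega
  · have e := ptolemy H N hs (K + j - N) K (by omega) (by omega)
    rw [rot_alt H N h0 hz hN (K + 1) j (by omega) (by omega),
      rot_alt H N h0 hz hN K j (by omega) (by omega),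
      rot_alt H N h0 hz hN (K + 1) (j - 1) (by omega) (by omega),
      rot_alt H N h0 hz hN K (j + 1) (by omega) (by omega),
      show K + 1 + j - N = K + j - N + 1 by omega, show K + 1 + (j - 1) - N = K + j - N by omega,
      show K + (j + 1) - N = K + j - N + 1 by omega]
    omega

theorem rot_step (H : ℕ → ℤ) (N : ℕ) (h0 : ∀ i ≤ N, 0 ≤ H i) (hz : H 0 = 0) (hN : H N = 0)
    (hs : ∀ i < N, H (i + 1) = H i + 1 ∨ H (i + 1) = H i - 1)
    (K : ℕ) (hK : K + 1 ≤ N) (r r' : ℕ → ℤ) (hr : ∀ j ≤ N, r j = rot H N (K + 1) j)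
    (hr0 : r' 0 = 0) (hrN : r' N = 0)
    (hrule : ∀ j, 1 ≤ j → j < N → r j + r' j = max (r (j - 1) + r' (j + 1)) 2) :
    ∀ j ≤ N, r' j = rot H N K j := by
  have key : ∀ t, t < N → r' (N - t) = rot H N K (N - t) := by
    intro t
    induction t with
    | zero =>
      intro _
      rw [Nat.sub_zero, hrN, rot_alt H N h0 hz hN K N (by omega) (by omega),
        Nat.add_sub_cancel, tdist_self]
    | succ t ih =>
      intro ht
      have i1 := ih (by omega)
      have i2 := hrule (N - (t + 1)) (by omega) (by omega)
      have i3 := rot_rule H N h0 hz hN hs K (N - (t + 1)) hK (by omega) (by omega)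
      rw [show N - (t + 1) + 1 = N - t by omega] at i2 i3
      rw [hr _ (by omega), hr _ (by omega), i1] at i2
      omega
  intro j hj
  rcases Nat.eq_zero_or_pos j with rfl | hj0
  · rw [hr0]; unfold rot; rw [if_pos (by omega), Nat.add_zero, tdist_self]
  · have := key (N - j) (by omega)
    rwa [show N - (N - j) = j by omega] at this

/-- hypotheses on the spacetime of two nested paths -/
structure Nested (m : ℕ) (n : ℤ) (A B : ℕ → ℕ → ℤ) : Prop where
  A0 : ∀ s, A s 0 = 0
  B0 : ∀ s, B s 0 = 0
  B1 : ∀ s, B s 1 = 0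
  Am : ∀ s, A s m = n
  Am1 : ∀ s, A s (m + 1) = n
  Bm1 : ∀ s, B s (m + 1) = n
  Amono : ∀ s, ∀ i ≤ m, A s i ≤ A s (i + 1) ∧ A s (i + 1) ≤ A s i + 1
  Bmono : ∀ s, ∀ i ≤ m, B s i ≤ B s (i + 1) ∧ B s (i + 1) ≤ B s i + 1
  BA : ∀ s, ∀ i ≤ m, B s (i + 1) ≤ A s i
  Across : ∀ s, ∀ i ≤ m, A s i ≤ A (s + 1) (i + 1) ∧ A (s + 1) (i + 1) ≤ A s i + 1
  Bcross : ∀ s, ∀ i ≤ m, B s i ≤ B (s + 1) (i + 1) ∧ B (s + 1) (i + 1) ≤ B s i + 1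
  BAcross : ∀ s, ∀ i ≤ m, B (s + 1) (i + 1) ≤ A s i
  recA : ∀ s, ∀ i, i + 1 ≤ m → A (s + 1) (i + 1) =
    max (B (s + 1) (i + 2)) (A (s + 1) (i + 2) + A s i - A s (i + 1))
  recB : ∀ s, ∀ i, i + 1 ≤ m → B (s + 1) (i + 1) =
    min (A s i) (B (s + 1) (i + 2) + B s i - B s (i + 1))

def evenRow (A B : ℕ → ℕ → ℤ) (s j : ℕ) : ℤ :=
  if j % 2 = 0 then 2 * (A s (j / 2) - B s (j / 2))
  else 2 * (A s (j / 2) - B s (j / 2 + 1)) + 1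

def oddRow (m : ℕ) (A B : ℕ → ℕ → ℤ) (s j : ℕ) : ℤ :=
  if j = 0 ∨ j = 2 * (m + 1) then 0
  else if j % 2 = 0 then 2 * (A s (j / 2 - 1) - B (s + 1) (j / 2 + 1)) + 2
  else 2 * (A s (j / 2) - B (s + 1) (j / 2 + 1)) + 1

theorem evenRow_even (A B : ℕ → ℕ → ℤ) (s i : ℕ) :
    evenRow A B s (2 * i) = 2 * (A s i - B s i) := by
  unfold evenRow; rw [if_pos (by omega), show 2 * i / 2 = i by omega]

theorem evenRow_odd (A B : ℕ → ℕ → ℤ) (s i : ℕ) :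
    evenRow A B s (2 * i + 1) = 2 * (A s i - B s (i + 1)) + 1 := by
  unfold evenRow; rw [if_neg (by omega), show (2 * i + 1) / 2 = i by omega]

theorem oddRow_even (m : ℕ) (A B : ℕ → ℕ → ℤ) (s i : ℕ) (h : i + 1 ≤ m) :
    oddRow m A B s (2 * (i + 1)) = 2 * (A s i - B (s + 1) (i + 2)) + 2 := by
  unfold oddRow
  rw [if_neg (by omega), if_pos (by omega), show 2 * (i + 1) / 2 = i + 1 by omega]
  rfl

theorem oddRow_odd (m : ℕ) (A B : ℕ → ℕ → ℤ) (s i : ℕ) :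
    oddRow m A B s (2 * i + 1) = 2 * (A s i - B (s + 1) (i + 1)) + 1 := by
  unfold oddRow
  rw [if_neg (by omega), if_neg (by omega), show (2 * i + 1) / 2 = i by omega]

theorem Nested.rule1 {m : ℕ} {n : ℤ} {A B : ℕ → ℕ → ℤ} (h : Nested m n A B) (hm : 1 ≤ m) (s : ℕ)
    (j : ℕ) (hj : 1 ≤ j) (hj' : j < 2 * (m + 1)) :
    evenRow A B s j + oddRow m A B s j
      = max (evenRow A B s (j - 1) + oddRow m A B s (j + 1)) 2 := by
  obtain ⟨i, rfl | rfl⟩ : ∃ i, j = 2 * (i + 1) ∨ j = 2 * i + 1 :=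
    ⟨(j - 1) / 2, by omega⟩
  · rw [show 2 * (i + 1) - 1 = 2 * i + 1 by omega, evenRow_even, evenRow_odd,
      oddRow_even _ _ _ _ _ (by omega), oddRow_odd]
    have h1 := h.BA s i (by omega)
    have h2 := h.BAcross s (i + 1) (by omega)
    simp only [add_assoc, Nat.reduceAdd] at *
    omega
  · rw [show 2 * i + 1 - 1 = 2 * i by omega, evenRow_even, evenRow_odd, oddRow_odd]
    have h1 := h.BA s i (by omega)
    have h2 := h.BAcross s i (by omega)
    by_cases hi : i = m
    · subst hi
      have : oddRow i A B s (2 * i + 1 + 1) = 0 := by unfold oddRow; rw [if_pos (by omega)]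
      rw [this]
      have h3 := h.Am s
      have h4 := h.Bm1 s
      have h5 := h.Bm1 (s + 1)
      have h6 := h.Bmono s i le_rfl
      omega
    · rw [show 2 * i + 1 + 1 = 2 * (i + 1) by ring, oddRow_even _ _ _ _ _ (by omega)]
      have h3 := h.recB s i (by omega)
      have h4 := h.Bmono s i (by omega)
      have h5 := h.Bcross s i (by omega)
      have h6 := h.Bcross s (i + 1) (by omega)
      simp only [add_assoc, Nat.reduceAdd] at *
      omega

theorem Nested.rule2 {m : ℕ} {n : ℤ} {A B : ℕ → ℕ → ℤ} (h : Nested m n A B) (hm : 1 ≤ m) (s : ℕ)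
    (j : ℕ) (hj : 1 ≤ j) (hj' : j < 2 * (m + 1)) :
    oddRow m A B s j + evenRow A B (s + 1) j
      = max (oddRow m A B s (j - 1) + evenRow A B (s + 1) (j + 1)) 2 := by
  obtain ⟨i, rfl | rfl⟩ : ∃ i, j = 2 * (i + 1) ∨ j = 2 * i + 1 :=
    ⟨(j - 1) / 2, by omega⟩
  · rw [show 2 * (i + 1) - 1 = 2 * i + 1 by omega, evenRow_even, evenRow_odd,
      oddRow_even _ _ _ _ _ (by omega), oddRow_odd]
    have h1 := h.BA (s + 1) (i + 1) (by omega)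
    have h2 := h.BAcross s i (by omega)
    simp only [add_assoc, Nat.reduceAdd] at *
    omega
  · rw [show 2 * i + 1 - 1 = 2 * i by omega, show 2 * i + 1 + 1 = 2 * (i + 1) by ring,
      evenRow_even, evenRow_odd, oddRow_odd]
    rcases i with _ | i
    · have : oddRow m A B s (2 * 0) = 0 := by unfold oddRow; rw [if_pos (by omega)]
      rw [this]
      have h1 := h.A0 s
      have h2 := h.A0 (s + 1)
      have h3 := h.B1 (s + 1)
      have h4 := h.Amono (s + 1) 0 (by omega)
      simp only [zero_add] at *
      omega
    · rw [oddRow_even _ _ _ _ _ (by omega)]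
      have h1 := h.BA (s + 1) (i + 1) (by omega)
      have h2 := h.BAcross s (i + 1) (by omega)
      have h3 := h.recA s i (by omega)
      have h4 := h.Amono s i (by omega)
      have h5 := h.Across s i (by omega)
      have h6 := h.Across s (i + 1) (by omega)
      simp only [add_assoc, Nat.reduceAdd] at *
      omega

theorem Nested.row_periodic {m : ℕ} {n : ℤ} {A B : ℕ → ℕ → ℤ} (h : Nested m n A B) (hm : 1 ≤ m)
    (s : ℕ) (j : ℕ) (hj : j ≤ 2 * (m + 1)) :
    evenRow A B (s + (m + 1)) j = evenRow A B s j := by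
  have e0 : ∀ s, evenRow A B s 0 = 0 := by
    intro s
    have := evenRow_even A B s 0
    rw [h.A0, h.B0] at this
    simpa using this
  have eN : ∀ s, evenRow A B s (2 * (m + 1)) = 0 := by
    intro s
    rw [evenRow_even, h.Am1, h.Bm1]; ring
  have h0 : ∀ i ≤ 2 * (m + 1), 0 ≤ evenRow A B s i := by
    intro i hi
    obtain ⟨k, rfl | rfl⟩ : ∃ k, i = 2 * k ∨ i = 2 * k + 1 := ⟨i / 2, by omega⟩
    · rcases k with _ | k
      · rw [mul_zero, e0]
      · rw [evenRow_even]
        have h1 := h.BA s k (by omega)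
        have h2 := h.Amono s k (by omega)
        omega
    · rw [evenRow_odd]
      have h1 := h.BA s k (by omega)
      omega
  have hs : ∀ i < 2 * (m + 1), evenRow A B s (i + 1) = evenRow A B s i + 1 ∨
      evenRow A B s (i + 1) = evenRow A B s i - 1 := by
    intro i hi
    obtain ⟨k, rfl | rfl⟩ : ∃ k, i = 2 * k ∨ i = 2 * k + 1 := ⟨i / 2, by omega⟩
    · rw [evenRow_even, evenRow_odd]
      have h2 := h.Bmono s k (by omega)
      omega
    · rw [evenRow_odd, show 2 * k + 1 + 1 = 2 * (k + 1) by ring, evenRow_even]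
      have h2 := h.Amono s k (by omega)
      omega
  have step := rot_step (evenRow A B s) (2 * (m + 1)) h0 (e0 s) (eN s) hs
  have main : ∀ k ≤ m + 1, ∀ j ≤ 2 * (m + 1),
      evenRow A B (s + k) j = rot (evenRow A B s) (2 * (m + 1)) (2 * (m + 1) - 2 * k) j := by
    intro k
    induction k with
    | zero =>
      intro _ j hj
      rcases Nat.eq_zero_or_pos j with rfl | hj0
      · unfold rot
        rw [if_pos (by omega)]
        simp only [mul_zero, Nat.sub_zero, add_zero]
        rw [e0, tdist_self]
      · rw [rot_alt _ _ h0 (e0 s) (eN s) _ _ (by omega) (by omega)]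
        simp only [mul_zero, Nat.sub_zero, add_zero]
        rw [Nat.add_sub_cancel_left, tdist_N _ _ h0 (eN s) _ hj]
    | succ k ih =>
      intro hk
      have ih' := ih (by omega)
      have s1 := step (2 * (m + 1) - 2 * k - 1) (by omega) (evenRow A B (s + k))
        (oddRow m A B (s + k))
        (by rw [show 2 * (m + 1) - 2 * k - 1 + 1 = 2 * (m + 1) - 2 * k by omega]; exact ih')
        (by unfold oddRow; rw [if_pos (by omega)]) (by unfold oddRow; rw [if_pos (by omega)])
        (h.rule1 hm (s + k))
      have s2 := step (2 * (m + 1) - 2 * (k + 1)) (by omega) (oddRow m A B (s + k))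
        (evenRow A B (s + k + 1))
        (by rw [show 2 * (m + 1) - 2 * (k + 1) + 1 = 2 * (m + 1) - 2 * k - 1 by omega]; exact s1)
        (e0 _) (eN _)
        (h.rule2 hm (s + k))
      exact s2
  rw [main (m + 1) le_rfl j hj, Nat.sub_self]
  unfold rot
  rw [if_pos (by omega), zero_add, tdist_zero _ _ h0 (e0 s) j hj]

theorem Nested.periodic {m : ℕ} {n : ℤ} {A B : ℕ → ℕ → ℤ} (h : Nested m n A B) (hm : 1 ≤ m)
    (s : ℕ) (i : ℕ) (hi : i ≤ m + 1) :
    A (s + (m + 1)) i = A s i ∧ B (s + (m + 1)) i = B s i := by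
  induction i with
  | zero => simp only [h.A0, h.B0, and_self]
  | succ i ih =>
    have i1 := ih (by omega)
    have r1 := h.row_periodic hm s (2 * i + 1) (by omega)
    have r2 := h.row_periodic hm s (2 * (i + 1)) (by omega)
    rw [evenRow_odd, evenRow_odd] at r1
    rw [evenRow_even, evenRow_even] at r2
    omega

theorem rowmo_lower {P : Type*} [PartialOrder P] (I : Set P) : IsLowerSet (rowmo I) := by
  rintro x y hxy ⟨m, hm, hx⟩
  exact ⟨m, hm, hxy.trans hx⟩

theorem rowmo_iterate_lower {P : Type*} [PartialOrder P] (I : Set P) (hI : IsLowerSet I) (n : ℕ) :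
    IsLowerSet (rowmo^[n] I) := by
  cases n with
  | zero => exact hI
  | succ n => rw [Function.iterate_succ_apply']; exact rowmo_lower _

theorem rowmo_strict {P : Type*} [PartialOrder P] {I : Set P} {x y : P} (hx : x ∈ rowmo I)
    (hy : y < x) : y ∈ I := by
  obtain ⟨m, hm, hxm⟩ := hx
  by_contra h
  exact absurd (hm.2 h (hy.le.trans hxm)) (not_le_of_gt (hy.trans_le hxm))

theorem exists_min_compl {P : Type*} [PartialOrder P] [Finite P] (I : Set P) (p : P) (hp : p ∉ I) :
    ∃ m, Minimal (fun y => y ∉ I) m ∧ m ≤ p := by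
  obtain ⟨m, h1, h2⟩ := (Set.toFinite {y | y ∉ I}).exists_le_minimal (a := p) hp
  exact ⟨m, h2, h1⟩

theorem rowmo_inj_aux {P : Type*} [PartialOrder P] [Finite P] {I I' : Set P} (hI : IsLowerSet I)
    (h : rowmo I = rowmo I') : I ⊆ I' := by
  intro p hp
  by_contra hp'
  obtain ⟨m, hm, hmp⟩ := exists_min_compl I' p hp'
  have hmI : m ∈ I := hI hmp hp
  have h1 : m ∈ rowmo I := by rw [h]; exact ⟨m, hm, le_rfl⟩
  obtain ⟨m2, hm2, hmm2⟩ := h1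
  have hlt : m < m2 := lt_of_le_of_ne hmm2 (by rintro rfl; exact hm2.1 hmI)
  have h2 : m2 ∈ rowmo I' := by rw [← h]; exact ⟨m2, hm2, le_rfl⟩
  exact hm.1 (rowmo_strict h2 hlt)

theorem rowmo_inj {P : Type*} [PartialOrder P] [Finite P] {I I' : Set P} (hI : IsLowerSet I)
    (hI' : IsLowerSet I') (h : rowmo I = rowmo I') : I = I' :=
  Set.Subset.antisymm (rowmo_inj_aux hI h) (rowmo_inj_aux hI' h.symm)

theorem rowmo_iterate_inj {P : Type*} [PartialOrder P] [Finite P] (n : ℕ) {I I' : Set P}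
    (hI : IsLowerSet I) (hI' : IsLowerSet I') (h : rowmo^[n] I = rowmo^[n] I') : I = I' := by
  induction n with
  | zero => exact h
  | succ n ih =>
    rw [Function.iterate_succ_apply', Function.iterate_succ_apply'] at h
    exact ih (rowmo_inj (rowmo_iterate_lower _ hI _) (rowmo_iterate_lower _ hI' _) h)

/-- membership with integer coordinates -/
def FF {a b : ℕ} (I : Set (Fin a × Fin b × Fin 2)) (x y z : ℤ) : Prop :=
  ∃ p ∈ I, ((p.1 : ℕ) : ℤ) = x ∧ ((p.2.1 : ℕ) : ℤ) = y ∧ ((p.2.2 : ℕ) : ℤ) = z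

theorem exP (a b : ℕ) (x y z : ℤ) (hx : 0 ≤ x) (hxa : x < a) (hy : 0 ≤ y) (hyb : y < b)
    (hz : 0 ≤ z) (hz2 : z < 2) :
    ∃ p : Fin a × Fin b × Fin 2,
      ((p.1 : ℕ) : ℤ) = x ∧ ((p.2.1 : ℕ) : ℤ) = y ∧ ((p.2.2 : ℕ) : ℤ) = z := by
  refine ⟨(⟨x.toNat, by omega⟩, ⟨y.toNat, by omega⟩, ⟨z.toNat, by omega⟩), ?_, ?_, ?_⟩ <;>
    simp <;> omega

theorem leP {a b : ℕ} {p q : Fin a × Fin b × Fin 2} :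
    p ≤ q ↔ ((p.1 : ℕ) : ℤ) ≤ (q.1 : ℕ) ∧ ((p.2.1 : ℕ) : ℤ) ≤ (q.2.1 : ℕ) ∧
      ((p.2.2 : ℕ) : ℤ) ≤ (q.2.2 : ℕ) := by
  simp only [Prod.le_def, Fin.le_def, Nat.cast_le]

theorem eqP {a b : ℕ} {p q : Fin a × Fin b × Fin 2} (h1 : ((p.1 : ℕ) : ℤ) = (q.1 : ℕ))
    (h2 : ((p.2.1 : ℕ) : ℤ) = (q.2.1 : ℕ)) (h3 : ((p.2.2 : ℕ) : ℤ) = (q.2.2 : ℕ)) : p = q :=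
  le_antisymm (leP.2 ⟨h1.le, h2.le, h3.le⟩) (leP.2 ⟨h1.ge, h2.ge, h3.ge⟩)

theorem FF_mem {a b : ℕ} {I : Set (Fin a × Fin b × Fin 2)} (p : Fin a × Fin b × Fin 2) :
    FF I (p.1 : ℕ) (p.2.1 : ℕ) (p.2.2 : ℕ) ↔ p ∈ I := by
  constructor
  · rintro ⟨q, hq, h1, h2, h3⟩
    rwa [← eqP h1 h2 h3]
  · intro h
    exact ⟨p, h, rfl, rfl, rfl⟩

theorem FF_bd {a b : ℕ} {I : Set (Fin a × Fin b × Fin 2)} {x y z : ℤ} (h : FF I x y z) :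
    0 ≤ x ∧ x < a ∧ 0 ≤ y ∧ y < b ∧ 0 ≤ z ∧ z < 2 := by
  obtain ⟨p, _, h1, h2, h3⟩ := h
  have := p.1.2
  have := p.2.1.2
  have := p.2.2.2
  omega

theorem FF_lower {a b : ℕ} {I : Set (Fin a × Fin b × Fin 2)} (hI : IsLowerSet I)
    {x y z x' y' z' : ℤ} (h : FF I x y z) (hx : 0 ≤ x') (hx' : x' ≤ x) (hy : 0 ≤ y')
    (hy' : y' ≤ y) (hz : 0 ≤ z') (hz' : z' ≤ z) : FF I x' y' z' := by
  have hb := FF_bd h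
  obtain ⟨p, hp, h1, h2, h3⟩ := h
  obtain ⟨q, g1, g2, g3⟩ := exP a b x' y' z' hx (by omega) hy (by omega) hz (by omega)
  refine ⟨q, hI (leP.2 ?_) hp, g1, g2, g3⟩
  omega

theorem FF_strict {a b : ℕ} {I : Set (Fin a × Fin b × Fin 2)}
    {x y z x' y' z' : ℤ} (h : FF (rowmo I) x y z) (hx : 0 ≤ x') (hx' : x' ≤ x) (hy : 0 ≤ y')
    (hy' : y' ≤ y) (hz : 0 ≤ z') (hz' : z' ≤ z) (hlt : x' + y' + z' < x + y + z) :
    FF I x' y' z' := by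
  have hb := FF_bd h
  obtain ⟨p, hp, h1, h2, h3⟩ := h
  obtain ⟨q, g1, g2, g3⟩ := exP a b x' y' z' hx (by omega) hy (by omega) hz (by omega)
  refine ⟨q, rowmo_strict hp (lt_of_le_not_ge (leP.2 (by omega)) ?_), g1, g2, g3⟩
  rw [leP]
  omega

theorem FF_rule {a b : ℕ} {I : Set (Fin a × Fin b × Fin 2)} (hI : IsLowerSet I)
    {x y z : ℤ} (hx : 0 ≤ x) (hxa : x < a) (hy : 0 ≤ y) (hyb : y < b) (hz : 0 ≤ z) (hz2 : z < 2) :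
    FF (rowmo I) x y z ↔ FF (rowmo I) (x + 1) y z ∨ FF (rowmo I) x (y + 1) z ∨
      FF (rowmo I) x y (z + 1) ∨ (¬ FF I x y z ∧ (x = 0 ∨ FF I (x - 1) y z) ∧
      (y = 0 ∨ FF I x (y - 1) z) ∧ (z = 0 ∨ FF I x y (z - 1))) := by
  constructor
  · intro h
    have h' := h
    obtain ⟨p, ⟨m, hm, hpm⟩, h1, h2, h3⟩ := h
    have hmr : FF (rowmo I) (m.1 : ℕ) (m.2.1 : ℕ) (m.2.2 : ℕ) := (FF_mem m).2 ⟨m, hm, le_rfl⟩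
    rw [leP] at hpm
    by_cases c1 : x + 1 ≤ (m.1 : ℕ)
    · exact Or.inl (FF_lower (rowmo_lower I) hmr (by omega) c1 hy (by omega) hz (by omega))
    by_cases c2 : y + 1 ≤ (m.2.1 : ℕ)
    · exact Or.inr (Or.inl
        (FF_lower (rowmo_lower I) hmr hx (by omega) (by omega) c2 hz (by omega)))
    by_cases c3 : z + 1 ≤ (m.2.2 : ℕ)
    · exact Or.inr (Or.inr (Or.inl
        (FF_lower (rowmo_lower I) hmr hx (by omega) hy (by omega) (by omega) c3)))
    right; right; right
    refine ⟨?_, ?_, ?_, ?_⟩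
    · intro hf
      have : p = m := eqP (by omega) (by omega) (by omega)
      subst this
      rw [← h1, ← h2, ← h3, FF_mem] at hf
      exact hm.1 hf
    · rcases hx.eq_or_lt with h0 | h0
      · exact Or.inl h0.symm
      · exact Or.inr (FF_strict h' (by omega) (by omega) hy le_rfl hz le_rfl (by omega))
    · rcases hy.eq_or_lt with h0 | h0
      · exact Or.inl h0.symm
      · exact Or.inr (FF_strict h' hx le_rfl (by omega) (by omega) hz le_rfl (by omega))
    · rcases hz.eq_or_lt with h0 | h0
      · exact Or.inl h0.symm
      · exact Or.inr (FF_strict h' hx le_rfl hy le_rfl (by omega) (by omega) (by omega))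
  · rintro (h | h | h | ⟨h1, h2, h3, h4⟩)
    · exact FF_lower (rowmo_lower I) h hx (by omega) hy le_rfl hz le_rfl
    · exact FF_lower (rowmo_lower I) h hx le_rfl hy (by omega) hz le_rfl
    · exact FF_lower (rowmo_lower I) h hx le_rfl hy le_rfl hz (by omega)
    · obtain ⟨p, rfl, rfl, rfl⟩ := exP a b x y z hx hxa hy hyb hz hz2
      refine ⟨p, ⟨p, ⟨fun hp => h1 ((FF_mem p).2 hp), ?_⟩, le_rfl⟩, rfl, rfl, rfl⟩
      intro q hq hqp
      rw [leP] at hqp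
      rw [leP]
      by_contra hc
      apply hq
      rw [← FF_mem]
      by_cases c1 : ((q.1 : ℕ) : ℤ) < (p.1 : ℕ)
      · exact FF_lower hI (h2.resolve_left (by omega)) (by omega) (by omega) (by omega)
          (by omega) (by omega) (by omega)
      by_cases c2 : ((q.2.1 : ℕ) : ℤ) < (p.2.1 : ℕ)
      · exact FF_lower hI (h3.resolve_left (by omega)) (by omega) (by omega) (by omega)
          (by omega) (by omega) (by omega)
      · exact FF_lower hI (h4.resolve_left (by omega)) (by omega) (by omega) (by omega)
          (by omega) (by omega) (by omega)

/-- the recombined slices of the rowmotion orbit, extended to all integer coordinates -/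
def JJ {a b : ℕ} (I : ℕ → Set (Fin a × Fin b × Fin 2)) (s : ℕ) (z x y : ℤ) : Prop :=
  x < a ∧ y < b ∧ (x < 0 ∨ y < 0 ∨ FF (I (s + y.toNat)) x y z)

section slices

variable {a b : ℕ} {I : ℕ → Set (Fin a × Fin b × Fin 2)}

theorem JJ_x (hI : ∀ t, IsLowerSet (I t)) {s : ℕ} {z x y : ℤ} (hz : 0 ≤ z)
    (h : JJ I s z (x + 1) y) : JJ I s z x y := by
  obtain ⟨h1, h2, h3⟩ := h
  refine ⟨by omega, h2, ?_⟩
  by_contra hc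
  push Not at hc
  obtain ⟨c1, c2, c3⟩ := hc
  rcases h3 with h3 | h3 | h3
  · omega
  · omega
  · exact c3 (FF_lower (hI _) h3 c1 (by omega) c2 le_rfl hz le_rfl)

theorem JJ_y (hr : ∀ t, I (t + 1) = rowmo (I t)) {s : ℕ} {z x y : ℤ} (hz : 0 ≤ z)
    (h : JJ I s z x (y + 1)) : JJ I s z x y := by
  obtain ⟨h1, h2, h3⟩ := h
  refine ⟨h1, by omega, ?_⟩
  by_contra hc
  push Not at hc
  obtain ⟨c1, c2, c3⟩ := hc
  rcases h3 with h3 | h3 | h3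
  · omega
  · omega
  · rw [show s + (y + 1).toNat = (s + y.toNat) + 1 by omega, hr] at h3
    exact c3 (FF_strict h3 c1 le_rfl c2 (by omega) hz le_rfl (by omega))

theorem JJ_z (hI : ∀ t, IsLowerSet (I t)) {s : ℕ} {x y : ℤ}
    (h : JJ I s 1 x y) : JJ I s 0 x y := by
  obtain ⟨h1, h2, h3⟩ := h
  refine ⟨by omega, h2, ?_⟩
  by_contra hc
  push Not at hc
  obtain ⟨c1, c2, c3⟩ := hc
  rcases h3 with h3 | h3 | h3
  · omega
  · omega
  · exact c3 (FF_lower (hI _) h3 c1 le_rfl c2 le_rfl le_rfl (by omega))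

theorem JJ_crossY (hI : ∀ t, IsLowerSet (I t)) {s : ℕ} {z x y : ℤ} (hz : 0 ≤ z)
    (h : JJ I s z x y) : JJ I (s + 1) z x (y - 1) := by
  obtain ⟨h1, h2, h3⟩ := h
  refine ⟨by omega, by omega, ?_⟩
  by_contra hc
  push Not at hc
  obtain ⟨c1, c2, c3⟩ := hc
  rcases h3 with h3 | h3 | h3
  · omega
  · omega
  · rw [show s + 1 + (y - 1).toNat = s + y.toNat by omega] at c3
    exact c3 (FF_lower (hI _) h3 c1 le_rfl c2 (by omega) hz le_rfl)

theorem JJ_crossX (hr : ∀ t, I (t + 1) = rowmo (I t)) {s : ℕ} {z x y : ℤ} (hz : 0 ≤ z)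
    (h : JJ I (s + 1) z (x + 1) y) : JJ I s z x y := by
  obtain ⟨h1, h2, h3⟩ := h
  refine ⟨by omega, by omega, ?_⟩
  by_contra hc
  push Not at hc
  obtain ⟨c1, c2, c3⟩ := hc
  rcases h3 with h3 | h3 | h3
  · omega
  · omega
  · rw [show s + 1 + y.toNat = (s + y.toNat) + 1 by omega, hr] at h3
    exact c3 (FF_strict h3 c1 (by omega) c2 le_rfl hz le_rfl (by omega))

theorem JJ_crossZ (hr : ∀ t, I (t + 1) = rowmo (I t)) {s : ℕ} {x y : ℤ}
    (h : JJ I (s + 1) 1 x y) : JJ I s 0 x y := by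
  obtain ⟨h1, h2, h3⟩ := h
  refine ⟨by omega, by omega, ?_⟩
  by_contra hc
  push Not at hc
  obtain ⟨c1, c2, c3⟩ := hc
  rcases h3 with h3 | h3 | h3
  · omega
  · omega
  · rw [show s + 1 + y.toNat = (s + y.toNat) + 1 by omega, hr] at h3
    exact c3 (FF_strict h3 c1 le_rfl c2 le_rfl le_rfl (by omega) (by omega))

theorem JJ_box {s : ℕ} {z x y : ℤ} (hx : 0 ≤ x) (hxa : x < a) (hy : 0 ≤ y) (hyb : y < b) :
    JJ I s z x y ↔ FF (I (s + y.toNat)) x y z := by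
  unfold JJ
  constructor
  · rintro ⟨_, _, h | h | h⟩
    · omega
    · omega
    · exact h
  · intro h
    exact ⟨hxa, hyb, Or.inr (Or.inr h)⟩

theorem JJ_ruleBox (hI : ∀ t, IsLowerSet (I t)) (hr : ∀ t, I (t + 1) = rowmo (I t))
    {s : ℕ} {z x y : ℤ} (hx : 0 ≤ x) (hxa : x < a) (hy : 0 ≤ y) (hyb : y < b)
    (hz : 0 ≤ z) (hz2 : z < 2) :
    JJ I (s + 1) z x y ↔ JJ I (s + 1) z (x + 1) y ∨ JJ I s z x (y + 1) ∨
      FF (I (s + y.toNat + 1)) x y (z + 1) ∨ (¬ JJ I s z x y ∧ JJ I s z (x - 1) y ∧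
        JJ I (s + 1) z x (y - 1) ∧ (z = 0 ∨ FF (I (s + y.toNat)) x y (z - 1))) := by
  have e1 : JJ I (s + 1) z x y ↔ FF (rowmo (I (s + y.toNat))) x y z := by
    rw [JJ_box hx hxa hy hyb, show s + 1 + y.toNat = (s + y.toNat) + 1 by omega, hr]
  have e2 : JJ I (s + 1) z (x + 1) y ↔ FF (rowmo (I (s + y.toNat))) (x + 1) y z := by
    by_cases c : x + 1 < a
    · rw [JJ_box (by omega) c hy hyb, show s + 1 + y.toNat = (s + y.toNat) + 1 by omega, hr]
    · exact ⟨fun h => absurd h.1 c, fun h => absurd (FF_bd h).2.1 c⟩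
  have e3 : JJ I s z x (y + 1) ↔ FF (rowmo (I (s + y.toNat))) x (y + 1) z := by
    by_cases c : y + 1 < b
    · rw [JJ_box hx hxa (by omega) c, show s + (y + 1).toNat = (s + y.toNat) + 1 by omega, hr]
    · exact ⟨fun h => absurd h.2.1 c, fun h => absurd (FF_bd h).2.2.2.1 c⟩
  have e4 : JJ I s z x y ↔ FF (I (s + y.toNat)) x y z := JJ_box hx hxa hy hyb
  have e5 : JJ I s z (x - 1) y ↔ (x = 0 ∨ FF (I (s + y.toNat)) (x - 1) y z) := by
    rcases hx.eq_or_lt with c | c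
    · exact ⟨fun h => Or.inl c.symm, fun h => ⟨by omega, hyb, Or.inl (by omega)⟩⟩
    · rw [JJ_box (by omega) (by omega) hy hyb]
      exact ⟨Or.inr, fun h => h.resolve_left (by omega)⟩
  have e6 : JJ I (s + 1) z x (y - 1) ↔ (y = 0 ∨ FF (I (s + y.toNat)) x (y - 1) z) := by
    rcases hy.eq_or_lt with c | c
    · exact ⟨fun h => Or.inl c.symm, fun h => ⟨hxa, by omega, Or.inr (Or.inl (by omega))⟩⟩
    · rw [JJ_box hx hxa (by omega) (by omega),
        show s + 1 + (y - 1).toNat = s + y.toNat by omega]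
      exact ⟨Or.inr, fun h => h.resolve_left (by omega)⟩
  rw [e1, e2, e3, e4, e5, e6, hr]
  exact FF_rule (hI _) hx hxa hy hyb hz hz2

theorem JJ_rule0 (hI : ∀ t, IsLowerSet (I t)) (hr : ∀ t, I (t + 1) = rowmo (I t))
    (s : ℕ) (x y : ℤ) :
    JJ I (s + 1) 0 x y ↔ JJ I (s + 1) 0 (x + 1) y ∨ JJ I s 0 x (y + 1) ∨
      JJ I (s + 1) 1 x y ∨ (¬ JJ I s 0 x y ∧ JJ I s 0 (x - 1) y ∧ JJ I (s + 1) 0 x (y - 1)) := by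
  by_cases hxa : x < a
  swap
  · unfold JJ
    constructor
    · intro h; omega
    · rintro (h | h | h | h) <;> omega
  by_cases hyb : y < b
  swap
  · unfold JJ
    constructor
    · intro h; omega
    · rintro (h | h | h | h) <;> omega
  by_cases hx : 0 ≤ x
  swap
  · exact ⟨fun _ => Or.inr (Or.inr (Or.inl ⟨hxa, hyb, Or.inl (by omega)⟩)),
      fun _ => ⟨hxa, hyb, Or.inl (by omega)⟩⟩
  by_cases hy : 0 ≤ y
  swap
  · exact ⟨fun _ => Or.inr (Or.inr (Or.inl ⟨hxa, hyb, Or.inr (Or.inl (by omega))⟩)),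
      fun _ => ⟨hxa, hyb, Or.inr (Or.inl (by omega))⟩⟩
  rw [JJ_ruleBox hI hr hx hxa hy hyb le_rfl (by norm_num), JJ_box (z := 1) hx hxa hy hyb,
    show s + 1 + y.toNat = s + y.toNat + 1 by omega]
  simp

theorem JJ_rule1 (hI : ∀ t, IsLowerSet (I t)) (hr : ∀ t, I (t + 1) = rowmo (I t))
    (s : ℕ) (x y : ℤ) (hlo : 2 ≤ x - y + 1 + b) (hhi : x - y + 1 ≤ a) :
    JJ I (s + 1) 1 x y ↔ JJ I (s + 1) 1 (x + 1) y ∨ JJ I s 1 x (y + 1) ∨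
      (¬ JJ I s 1 x y ∧ JJ I s 1 (x - 1) y ∧ JJ I (s + 1) 1 x (y - 1) ∧ JJ I s 0 x y) := by
  by_cases hxa : x < a
  swap
  · unfold JJ
    constructor
    · intro h; omega
    · rintro (h | h | h) <;> omega
  by_cases hyb : y < b
  swap
  · unfold JJ
    constructor
    · intro h; omega
    · rintro (h | h | h) <;> omega
  by_cases hx : 0 ≤ x
  swap
  · exact ⟨fun _ => Or.inr (Or.inl ⟨hxa, by omega, Or.inl (by omega)⟩),
      fun _ => ⟨hxa, hyb, Or.inl (by omega)⟩⟩
  by_cases hy : 0 ≤ y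
  swap
  · exact ⟨fun _ => Or.inl ⟨by omega, hyb, Or.inr (Or.inl (by omega))⟩,
      fun _ => ⟨hxa, hyb, Or.inr (Or.inl (by omega))⟩⟩
  rw [JJ_ruleBox hI hr hx hxa hy hyb (by norm_num) (by norm_num), JJ_box (z := 0) hx hxa hy hyb]
  have : ¬ FF (I (s + y.toNat + 1)) x y 2 := by
    intro h
    have := (FF_bd h).2.2.2.2.2
    omega
  simp [this]

theorem thr_exists (n : ℤ) (Q : ℤ → Prop) (hd : ∀ x, Q (x + 1) → Q x) (hne : ∃ x, Q x)
    (hb : ∀ x, Q x → x < n) : ∃ t : ℤ, ∀ x, x < t ↔ Q x := by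
  obtain ⟨t, ht, hmax⟩ := Int.exists_greatest_of_bdd (P := Q) ⟨n, fun z hz => (hb z hz).le⟩ hne
  refine ⟨t + 1, fun x => ⟨fun hx => ?_, fun hx => by have := hmax x hx; omega⟩⟩
  have key : ∀ k : ℕ, Q (t - k) := by
    intro k
    induction k with
    | zero => simpa using ht
    | succ k ih => apply hd; convert ih using 1; push_cast; ring
  have := key (t - x).toNat
  rwa [show t - ((t - x).toNat : ℤ) = x by omega] at this

theorem exists_nested (hb : 0 < b) (hI : ∀ t, IsLowerSet (I t))
    (hr : ∀ t, I (t + 1) = rowmo (I t)) :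
    ∃ A B : ℕ → ℕ → ℤ, Nested (a + b) a A B ∧
      (∀ s i x, x < A s i ↔ JJ I s 0 x (x + b - i)) ∧
      (∀ s i x, 1 ≤ i → (x < B s i ↔ JJ I s 1 x (x + 1 + b - i))) := by
  have hA : ∀ s i : ℕ, ∃ t : ℤ, ∀ x, x < t ↔ JJ I s 0 x (x + b - i) := by
    intro s i
    refine thr_exists a _ (fun x hx => ?_) ⟨-1 - (a : ℤ), by omega, by omega, Or.inl (by omega)⟩
      (fun x hx => hx.1)
    have := JJ_x hI le_rfl hx
    exact JJ_y hr le_rfl (by convert this using 1; ring)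
  have hB : ∀ s i : ℕ, ∃ t : ℤ, ∀ x, x < t ↔ JJ I s 1 x (x + 1 + b - i) := by
    intro s i
    refine thr_exists a _ (fun x hx => ?_) ⟨-2 - (a : ℤ), by omega, by omega, Or.inl (by omega)⟩
      (fun x hx => hx.1)
    have := JJ_x hI (by norm_num) hx
    exact JJ_y hr (by norm_num) (by convert this using 1; ring)
  choose A hA using hA
  choose B' hB' using hB
  obtain ⟨B, hB, hB0⟩ : ∃ B : ℕ → ℕ → ℤ,
      (∀ s i x, 1 ≤ i → (x < B s i ↔ JJ I s 1 x (x + 1 + b - i))) ∧ ∀ s, B s 0 = 0 :=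
    ⟨fun s i => if i = 0 then 0 else B' s i,
      fun s i x hi => by simp only [show i ≠ 0 by omega, if_false]; exact hB' s i x,
      fun s => by simp⟩
  have A0 : ∀ s, A s 0 = 0 := by
    intro s
    refine eq_of_forall_lt_iff fun x => ?_
    rw [hA]
    exact ⟨fun h => by have := h.2.1; push_cast at this; omega,
      fun h => ⟨by omega, by push_cast; omega, Or.inl h⟩⟩
  have B1 : ∀ s, B s 1 = 0 := by
    intro s
    refine eq_of_forall_lt_iff fun x => ?_
    rw [hB _ _ _ le_rfl]
    exact ⟨fun h => by have := h.2.1; push_cast at this; omega,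
      fun h => ⟨by omega, by push_cast; omega, Or.inl h⟩⟩
  have Am : ∀ s, A s (a + b) = a := by
    intro s
    refine eq_of_forall_lt_iff fun x => ?_
    rw [hA]
    exact ⟨fun h => h.1,
      fun h => ⟨by omega, by push_cast; omega, Or.inr (Or.inl (by push_cast; omega))⟩⟩
  have Am1 : ∀ s, A s (a + b + 1) = a := by
    intro s
    refine eq_of_forall_lt_iff fun x => ?_
    rw [hA]
    exact ⟨fun h => h.1,
      fun h => ⟨by omega, by push_cast; omega, Or.inr (Or.inl (by push_cast; omega))⟩⟩
  have Bm1 : ∀ s, B s (a + b + 1) = a := by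
    intro s
    refine eq_of_forall_lt_iff fun x => ?_
    rw [hB _ _ _ (by omega)]
    exact ⟨fun h => h.1,
      fun h => ⟨by omega, by push_cast; omega, Or.inr (Or.inl (by push_cast; omega))⟩⟩
  have le_of : ∀ t t' : ℤ, (∀ x, x < t → x < t') → t ≤ t' := by
    intro t t' h
    have := h (t - 1) (by omega)
    omega
  have le_of1 : ∀ t t' : ℤ, (∀ x, x + 1 < t → x < t') → t ≤ t' + 1 := by
    intro t t' h
    by_contra hc
    have := h (t - 2) (by omega)
    omega
  have Amono : ∀ s, ∀ i, A s i ≤ A s (i + 1) ∧ A s (i + 1) ≤ A s i + 1 := by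
    intro s i
    constructor
    · refine le_of _ _ fun x hx => ?_
      rw [hA] at hx ⊢
      exact JJ_y hr le_rfl (by convert hx using 1; push_cast; ring)
    · refine le_of1 _ _ fun x hx => ?_
      rw [hA] at hx ⊢
      exact JJ_x hI le_rfl (by convert hx using 1; push_cast; ring)
  have Bmono : ∀ s, ∀ i, B s i ≤ B s (i + 1) ∧ B s (i + 1) ≤ B s i + 1 := by
    intro s i
    rcases Nat.eq_zero_or_pos i with rfl | hi
    · rw [hB0, B1]; omega
    constructor
    · refine le_of _ _ fun x hx => ?_
      rw [hB _ _ _ (by omega)] at hx ⊢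
      exact JJ_y hr (by norm_num) (by convert hx using 1; push_cast; ring)
    · refine le_of1 _ _ fun x hx => ?_
      rw [hB _ _ _ (by omega)] at hx ⊢
      exact JJ_x hI (by norm_num) (by convert hx using 1; push_cast; ring)
  have BA : ∀ s, ∀ i, B s (i + 1) ≤ A s i := by
    intro s i
    refine le_of _ _ fun x hx => ?_
    rw [hB _ _ _ (by omega)] at hx
    rw [hA]
    exact JJ_z hI (by convert hx using 1; push_cast; ring)
  have Across : ∀ s, ∀ i, A s i ≤ A (s + 1) (i + 1) ∧ A (s + 1) (i + 1) ≤ A s i + 1 := by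
    intro s i
    constructor
    · refine le_of _ _ fun x hx => ?_
      rw [hA] at hx ⊢
      have := JJ_crossY hI le_rfl hx
      convert this using 1; push_cast; ring
    · refine le_of1 _ _ fun x hx => ?_
      rw [hA] at hx ⊢
      exact JJ_crossX hr le_rfl (by convert hx using 1; push_cast; ring)
  have Bcross : ∀ s, ∀ i, B s i ≤ B (s + 1) (i + 1) ∧ B (s + 1) (i + 1) ≤ B s i + 1 := by
    intro s i
    rcases Nat.eq_zero_or_pos i with rfl | hi
    · rw [hB0, B1]; omega
    constructor
    · refine le_of _ _ fun x hx => ?_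
      rw [hB _ _ _ (by omega)] at hx ⊢
      have := JJ_crossY hI (by norm_num) hx
      convert this using 1; push_cast; ring
    · refine le_of1 _ _ fun x hx => ?_
      rw [hB _ _ _ (by omega)] at hx ⊢
      exact JJ_crossX hr (by norm_num) (by convert hx using 1; push_cast; ring)
  have BAcross : ∀ s, ∀ i, B (s + 1) (i + 1) ≤ A s i := by
    intro s i
    refine le_of _ _ fun x hx => ?_
    rw [hB _ _ _ (by omega)] at hx
    rw [hA]
    exact JJ_crossZ hr (by convert hx using 1; push_cast; ring)
  refine ⟨A, B, ⟨A0, hB0, B1, Am, Am1, Bm1, fun s i _ => Amono s i, fun s i _ => Bmono s i,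
    fun s i _ => BA s i, fun s i _ => Across s i, fun s i _ => Bcross s i,
    fun s i _ => BAcross s i, ?_, ?_⟩, hA, hB⟩
  · intro s i hi
    refine eq_of_forall_lt_iff fun x => ?_
    have e := JJ_rule0 hI hr s x (x + b - (i + 1 : ℕ))
    have e1 := hA (s + 1) (i + 2) (x + 1)
    have e2 := hA s i x
    have e3 := hB (s + 1) (i + 2) x (by omega)
    have e4 := hA s (i + 1) x
    have e5 := hA s i (x - 1)
    have e6 := hA (s + 1) (i + 2) x
    rw [show x + 1 + b - ((i + 2 : ℕ) : ℤ) = x + b - (i + 1 : ℕ) by push_cast; ring] at e1 e3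
    rw [show x + b - (i : ℤ) = x + b - (i + 1 : ℕ) + 1 by push_cast; ring] at e2
    rw [show x - 1 + b - (i : ℤ) = x + b - (i + 1 : ℕ) by push_cast; ring] at e5
    rw [show x + b - ((i + 2 : ℕ) : ℤ) = x + b - (i + 1 : ℕ) - 1 by push_cast; ring] at e6
    rw [← hA, ← e1, ← e2, ← e3, ← e4, ← e5, ← e6] at e
    rw [e]
    have f1 := Amono s i
    have f2 := Across s (i + 1)
    simp only [add_assoc, Nat.reduceAdd] at *
    omega
  · intro s i hi
    rcases Nat.eq_zero_or_pos i with rfl | hi0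
    · have f1 := Bmono (s + 1) 1
      rw [zero_add, B1, A0, hB0, B1]
      rw [B1] at f1
      simp only [Nat.reduceAdd] at f1
      simp only [zero_add]
      omega
    refine eq_of_forall_lt_iff fun x => ?_
    have e := JJ_rule1 hI hr s x (x + 1 + b - (i + 1 : ℕ)) (by push_cast; omega)
      (by push_cast; omega)
    have e1 := hB (s + 1) (i + 2) (x + 1) (by omega)
    have e2 := hB s i x (by omega)
    have e3 := hA s i x
    have e4 := hB s (i + 1) x (by omega)
    have e5 := hB s i (x - 1) (by omega)
    have e6 := hB (s + 1) (i + 2) x (by omega)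
    rw [show x + 1 + 1 + b - ((i + 2 : ℕ) : ℤ) = x + 1 + b - (i + 1 : ℕ) by push_cast; ring] at e1
    rw [show x + b - (i : ℤ) = x + 1 + b - (i + 1 : ℕ) by push_cast; ring] at e3
    rw [show x + 1 + b - (i : ℤ) = x + 1 + b - (i + 1 : ℕ) + 1 by push_cast; ring] at e2
    rw [show x - 1 + 1 + b - (i : ℤ) = x + 1 + b - (i + 1 : ℕ) by push_cast; ring] at e5
    rw [show x + 1 + b - ((i + 2 : ℕ) : ℤ) = x + 1 + b - (i + 1 : ℕ) - 1 by
      push_cast; ring] at e6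
    rw [← hB _ _ _ (by omega), ← e1, ← e2, ← e3, ← e4, ← e5, ← e6] at e
    rw [e]
    have f1 := Bmono s i
    have f2 := Bcross s (i + 1)
    have f3 := BAcross s (i + 1)
    have f4 := Amono s i
    have f5 := BA s i
    simp only [add_assoc, Nat.reduceAdd] at *
    omega

end slices

theorem rowmo_period (a b : ℕ) (ha : 0 < a) (hb : 0 < b) (I0 : Set (Fin a × Fin b × Fin 2))
    (h0 : IsLowerSet I0) : rowmo^[a + b + 1] I0 = I0 := by
  let I : ℕ → Set (Fin a × Fin b × Fin 2) := fun t => rowmo^[t] I0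
  have hI : ∀ t, IsLowerSet (I t) := fun t => rowmo_iterate_lower I0 h0 t
  have hr : ∀ t, I (t + 1) = rowmo (I t) := fun t => Function.iterate_succ_apply' _ _ _
  obtain ⟨A, B, hN, hA, hB⟩ := exists_nested (I := I) hb hI hr
  have hp := hN.periodic (by omega)
  have key : I (b + (a + b + 1)) = I b := by
    ext p
    have b1 := p.1.2
    have b2 := p.2.1.2
    have b3 := p.2.2.2
    obtain ⟨x, hx⟩ : ∃ x : ℤ, x = (p.1 : ℕ) := ⟨_, rfl⟩
    obtain ⟨y, hy⟩ : ∃ y : ℤ, y = (p.2.1 : ℕ) := ⟨_, rfl⟩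
    have J1 : ∀ t z, JJ I (b - p.2.1 + t) z x y ↔ FF (I (b + t)) x y z := by
      intro t z
      rw [JJ_box (by omega) (by omega) (by omega) (by omega),
        show b - p.2.1 + t + y.toNat = b + t by omega]
    rw [← FF_mem, ← FF_mem (I := I b), ← hx, ← hy, ← J1 (a + b + 1)]
    have J2 := J1 0 ((p.2.2 : ℕ) : ℤ)
    simp only [add_zero] at J2
    rw [← J2]
    obtain hz | hz : ((p.2.2 : ℕ) : ℤ) = 0 ∨ ((p.2.2 : ℕ) : ℤ) = 1 := by omega
    · rw [hz]
      have e := hA (b - p.2.1) (x - y + b).toNat x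
      have e' := hA (b - p.2.1 + (a + b + 1)) (x - y + b).toNat x
      rw [show x + b - ((x - y + b).toNat : ℤ) = y by omega] at e e'
      rw [← e, ← e', (hp _ _ (by omega)).1]
    · rw [hz]
      have e := hB (b - p.2.1) (x - y + b + 1).toNat x (by omega)
      have e' := hB (b - p.2.1 + (a + b + 1)) (x - y + b + 1).toNat x (by omega)
      rw [show x + 1 + b - ((x - y + b + 1).toNat : ℤ) = y by omega] at e e'
      rw [← e, ← e', (hp _ _ (by omega)).2]
  have key2 : rowmo^[b] (rowmo^[a + b + 1] I0) = rowmo^[b] I0 := by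
    rw [← Function.iterate_add_apply]; exact key
  exact rowmo_iterate_inj b (rowmo_iterate_lower _ h0 _) h0 key2

theorem rowmo_empty_rank (a b k : ℕ) (p : Fin a × Fin b × Fin 2)
    (hp : p ∈ rowmo^[k] (∅ : Set (Fin a × Fin b × Fin 2))) :
    (p.1 : ℕ) + (p.2.1 : ℕ) + (p.2.2 : ℕ) < k := by
  induction k generalizing p with
  | zero => exact absurd hp (Set.notMem_empty _)
  | succ k ih =>
    rw [Function.iterate_succ_apply', ← FF_mem] at hp
    have step : ∀ x y z : ℤ, 0 ≤ x → x ≤ (p.1 : ℕ) → 0 ≤ y → y ≤ (p.2.1 : ℕ) → 0 ≤ z →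
        z ≤ (p.2.2 : ℕ) → x + y + z < (p.1 : ℕ) + (p.2.1 : ℕ) + (p.2.2 : ℕ) →
        x + y + z < k := by
      intro x y z h1 h2 h3 h4 h5 h6 h7
      obtain ⟨q, hq, g1, g2, g3⟩ := FF_strict hp h1 h2 h3 h4 h5 h6 h7
      have := ih q hq
      omega
    by_cases c1 : 0 < (p.1 : ℕ)
    · have := step ((p.1 : ℕ) - 1) (p.2.1 : ℕ) (p.2.2 : ℕ) (by omega) (by omega) (by omega)
        (by omega) (by omega) (by omega) (by omega)
      omega
    by_cases c2 : 0 < (p.2.1 : ℕ)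
    · have := step (p.1 : ℕ) ((p.2.1 : ℕ) - 1) (p.2.2 : ℕ) (by omega) (by omega) (by omega)
        (by omega) (by omega) (by omega) (by omega)
      omega
    by_cases c3 : 0 < (p.2.2 : ℕ)
    · have := step (p.1 : ℕ) (p.2.1 : ℕ) ((p.2.2 : ℕ) - 1) (by omega) (by omega) (by omega)
        (by omega) (by omega) (by omega) (by omega)
      omega
    omega

/-- Theorem 3.2 (Cameron–Fon-der-Flaass): the order of rowmotion on
`J(𝐚 × 𝐛 × 𝟐)` is exactly `a + b + 1`. -/
theorem order_rowmotion_height_two (a b : ℕ) (ha : 0 < a) (hb : 0 < b) :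
    IsLeast {m : ℕ | 0 < m ∧
      ∀ I : Set (Fin a × Fin b × Fin 2), IsLowerSet I → rowmo^[m] I = I}
      (a + b + 1) := by
  refine ⟨⟨by omega, fun I hI => rowmo_period a b ha hb I hI⟩, ?_⟩
  rintro m ⟨hm, h⟩
  by_contra hlt
  obtain ⟨k, rfl⟩ : ∃ k, m = k + 1 := ⟨m - 1, by omega⟩
  have h1 := h ∅ (isLowerSet_empty)
  rw [Function.iterate_succ_apply'] at h1
  obtain ⟨p, p1, p2, p3⟩ := exP a b (a - 1) (b - 1) 1 (by omega) (by omega) (by omega) (by omega)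
    (by omega) (by omega)
  have hp : p ∉ rowmo^[k] (∅ : Set (Fin a × Fin b × Fin 2)) := by
    intro hp
    have := rowmo_empty_rank a b k p hp
    omega
  obtain ⟨q, hq, _⟩ := exists_min_compl _ p hp
  have : q ∈ rowmo (rowmo^[k] (∅ : Set (Fin a × Fin b × Fin 2))) := ⟨q, hq, le_rfl⟩
  rw [h1] at this
  exact this
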